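/- There is a constant c > 0 such that for all n ≥ 2: if a monotone circuit of size S computes Match_n, then (log₂ S + 1)³ · (log₂ n)² ≥ c · n. -/

import Mathlib

/-- A monotone circuit (straight-line program) with input bits indexed by `ι`:
gate `i` is either an input variable, or the AND (`true`) / OR (`false`) of two
earlier gates. Its size is the number of gates. -/
structure MonCircuit (ι : Type) where
  size : ℕ
  gate : (i : Fin size) → ι ⊕ (Bool × Fin i.val × Fin i.val)

/-- Evaluation of the gates of a monotone circuit on input `x`. -/
def MonCircuit.eval {ι : Type} (C : MonCircuit ι) (x : ι → Bool) : (i : Fin C.size) → Bool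
  | i =>
    match C.gate i with
    | Sum.inl j => x j
    | Sum.inr (op, j, k) =>
      let a := C.eval x ⟨j.val, j.isLt.trans i.isLt⟩
      let b := C.eval x ⟨k.val, k.isLt.trans i.isLt⟩
      if op then a && b else a || b
  termination_by i => i.val

/-- `C` computes the boolean function `f` (given as a predicate on inputs):
the circuit is nonempty and its last gate outputs `true` exactly on inputs satisfying `f`. -/
def MonCircuit.Computes {ι : Type} (C : MonCircuit ι) (f : (ι → Bool) → Prop) : Prop :=
  ∃ h : 0 < C.size, ∀ x : ι → Bool,
    (C.eval x ⟨C.size - 1, Nat.sub_lt h Nat.one_pos⟩ = true ↔ f x)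

/-- A matching in `K_{n,n}`: a set of edges with pairwise distinct left endpoints
and pairwise distinct right endpoints. -/
def IsMatching {n : ℕ} (M : Finset (Fin n × Fin n)) : Prop :=
  ∀ e ∈ M, ∀ e' ∈ M, e ≠ e' → e.1 ≠ e'.1 ∧ e.2 ≠ e'.2

/-- `Match n x = 1` iff the bipartite graph `x ⊆ L × R` contains a perfect matching. -/
def MatchProp (n : ℕ) (x : Fin n × Fin n → Bool) : Prop :=
  ∃ M : Finset (Fin n × Fin n), IsMatching M ∧ M.card = n ∧ ∀ e ∈ M, x e = true

section SpreadFamilies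

open Finset
open scoped Classical

variable {V ι : Type*} [Fintype V] [DecidableEq V]

/-- The points with label zero. -/
noncomputable def zeroSet {q : ℕ} (x : V → Fin (q + 1)) : Finset V :=
  univ.filter fun v => x v = 0

/-- The points that have label zero in at least one of the blocks. -/
noncomputable def coverSet {q M : ℕ} (ω : Fin M → V → Fin (q + 1)) : Finset V :=
  univ.filter fun v => ∃ b, ω b v = 0

/-- The set `S` of size `w` is stuck over `W` if no member of the family inside `W ∪ S`
has fewer than `w` points outside `W`. -/
def IsStuck (I : Finset ι) (Z : ι → Finset V) (w : ℕ) (W S : Finset V) : Prop :=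
  S.card = w ∧ ∀ j ∈ I, Z j ⊆ W ∪ S → w ≤ (Z j \ W).card

theorem card_agree_off {q : ℕ} (S : Finset V) (y : V → Fin (q + 1)) :
    (univ.filter fun x : V → Fin (q + 1) => ∀ v ∉ S, x v = y v).card = (q + 1) ^ S.card := by
  have h : (univ.filter fun x : V → Fin (q + 1) => ∀ v ∉ S, x v = y v) =
      Fintype.piFinset fun v => if v ∈ S then univ else {y v} := by
    ext x
    simp only [mem_filter, mem_univ, true_and, Fintype.mem_piFinset]
    refine forall_congr' fun v => ?_
    by_cases hv : v ∈ S <;> simp [hv]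
  rw [h, Fintype.card_piFinset]
  simp [apply_ite Finset.card]

theorem card_isStuck_le {q w : ℕ} (I : Finset ι) (Z : ι → Finset V)
    (hw : ∀ i ∈ I, (Z i).card ≤ w) (S : Finset V) :
    (univ.filter fun x : V → Fin (q + 1) => IsStuck I Z w (zeroSet x) S).card ≤
      (q + 1) ^ w * (univ.filter fun y : V → Fin (q + 1) =>
        S ⊆ zeroSet y ∧ ∀ j ∈ I, Z j ⊆ zeroSet y → Z j = S).card := by
  let f : (V → Fin (q + 1)) → (V → Fin (q + 1)) := fun x v => if v ∈ S then 0 else x v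
  have hf : ∀ x, zeroSet (f x) = zeroSet x ∪ S := by
    intro x
    ext v
    by_cases hv : v ∈ S <;> simp [zeroSet, f, hv]
  refine (card_le_mul_card_image_of_maps_to (f := f) (t := univ.filter fun y =>
    S ⊆ zeroSet y ∧ ∀ j ∈ I, Z j ⊆ zeroSet y → Z j = S) ?_ ((q + 1) ^ w) ?_)
  · intro x hx
    simp only [mem_filter, mem_univ, true_and] at hx ⊢
    obtain ⟨hS, hx⟩ := hx
    rw [hf]
    refine ⟨subset_union_right, fun j hj hZ => ?_⟩
    have h1 := hx j hj hZ
    have h2 := hw j hj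
    have h3 : Z j \ zeroSet x = Z j := eq_of_subset_of_card_le sdiff_subset (h2.trans h1)
    refine eq_of_subset_of_card_le (fun v hv => ?_) ?_
    · have hv' := hZ hv
      rw [← h3] at hv
      rcases mem_union.1 hv' with h | h
      · exact absurd h (mem_sdiff.1 hv).2
      · exact h
    · rw [hS, ← h3]
      exact h1
  · intro y _
    by_cases hS : S.card = w
    · rw [← hS, ← card_agree_off S y]
      refine card_le_card fun x hx => ?_
      simp only [mem_filter, mem_univ, true_and] at hx ⊢
      intro v hv
      rw [← hx.2]
      simp [f, hv]
    · refine (card_eq_zero.2 ?_).trans_le (Nat.zero_le _)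
      refine filter_eq_empty_iff.2 fun x hx => ?_
      exact absurd (mem_filter.1 hx).2.1 hS

theorem sum_card_isStuck_le {q w H r : ℕ} (I : Finset ι) (Z : ι → Finset V)
    (hr : 16 * (q + 1) ≤ r) (hw0 : 0 < w)
    (hw : ∀ i ∈ I, (Z i).card ≤ w)
    (hsp : ∀ S : Finset V, S.Nonempty → (I.filter fun i => S ⊆ Z i).card * r ^ S.card ≤ H) :
    16 ^ w * ∑ x : V → Fin (q + 1), (I.filter fun i => IsStuck I Z w (zeroSet x) (Z i)).card ≤
      H * Fintype.card (V → Fin (q + 1)) := by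
  set b : Finset V → ℕ := fun S =>
    (univ.filter fun x : V → Fin (q + 1) => IsStuck I Z w (zeroSet x) S).card with hb
  set c : Finset V → Finset (V → Fin (q + 1)) := fun S => univ.filter fun y =>
    S ⊆ zeroSet y ∧ ∀ j ∈ I, Z j ⊆ zeroSet y → Z j = S with hc
  have h1 : ∑ x : V → Fin (q + 1), (I.filter fun i => IsStuck I Z w (zeroSet x) (Z i)).card =
      ∑ i ∈ I, b (Z i) := by
    simp only [hb, card_filter]
    exact sum_comm
  have h2 : ∑ i ∈ I, b (Z i) = ∑ S ∈ I.image Z, (I.filter fun i => Z i = S).card * b S := by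
    rw [← sum_fiberwise_of_maps_to (g := Z) (t := I.image Z) fun i hi => mem_image_of_mem Z hi]
    refine sum_congr rfl fun S _ => ?_
    rw [← smul_eq_mul, ← sum_const]
    exact sum_congr rfl fun i hi => by rw [(mem_filter.1 hi).2]
  have h3 : ∑ S ∈ I.image Z, (c S).card ≤ Fintype.card (V → Fin (q + 1)) := by
    rw [← card_biUnion]
    · exact card_le_univ _
    · intro S hS T hT hne
      refine disjoint_left.2 fun y hy hy' => hne ?_
      simp only [hc, mem_filter, mem_univ, true_and] at hy hy'
      obtain ⟨j, hj, rfl⟩ := mem_image.1 hS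
      exact hy'.2 j hj hy.1
  have h4 : ∀ S ∈ I.image Z, 16 ^ w * ((I.filter fun i => Z i = S).card * b S) ≤
      H * (c S).card := by
    intro S _
    by_cases hS : S.card = w
    · have h5 := card_isStuck_le (q := q) I Z hw S
      have h6 : (I.filter fun i => Z i = S).card * r ^ w ≤ H := by
        rw [← hS]
        refine le_trans ?_ (hsp S (card_pos.1 (by omega)))
        refine Nat.mul_le_mul_right _ (card_le_card fun i hi => ?_)
        simp only [mem_filter] at hi ⊢
        exact ⟨hi.1, hi.2.ge⟩
      have h7 : (16 * (q + 1)) ^ w ≤ r ^ w := Nat.pow_le_pow_left hr w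
      calc 16 ^ w * ((I.filter fun i => Z i = S).card * b S)
          ≤ 16 ^ w * ((I.filter fun i => Z i = S).card * ((q + 1) ^ w * (c S).card)) := by
            gcongr
        _ = (I.filter fun i => Z i = S).card * (16 * (q + 1)) ^ w * (c S).card := by
            rw [mul_pow]; ring
        _ ≤ (I.filter fun i => Z i = S).card * r ^ w * (c S).card := by gcongr
        _ ≤ H * (c S).card := by gcongr
    · have : b S = 0 := by
        refine card_eq_zero.2 (filter_eq_empty_iff.2 fun x _ hx => hS hx.1)
      simp [this]
  rw [h1, h2, mul_sum]
  refine (sum_le_sum h4).trans ?_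
  rw [← mul_sum]
  gcongr

theorem card_filter_fin_cons {β : Type*} [Fintype β] {M : ℕ} (P : (Fin (M + 1) → β) → Prop)
    [DecidablePred P] :
    (univ.filter P).card =
      ∑ x : β, (univ.filter fun ω : Fin M → β => P (Fin.cons x ω)).card := by
  simp only [card_filter]
  rw [← Fintype.sum_prod_type']
  exact (Fintype.sum_equiv (Fin.consEquiv fun _ => β) _ _ fun _ => rfl).symm

theorem coverSet_cons {q M : ℕ} (x : V → Fin (q + 1)) (ω : Fin M → V → Fin (q + 1)) :
    coverSet (Fin.cons x ω : Fin (M + 1) → V → Fin (q + 1)) = zeroSet x ∪ coverSet ω := by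
  ext v
  simp [coverSet, zeroSet, Fin.exists_fin_succ]

/-- A spread family of sets of size at most `w` has a member covered by `M` sparse random
blocks, up to failure probability `4 ^ w / 2 ^ M`. -/
theorem card_not_covered_le {q H r : ℕ} (hr : 16 * (q + 1) ≤ r) (hH : 0 < H) :
    ∀ (M w : ℕ) (I : Finset ι) (Z : ι → Finset V),
      (∀ i ∈ I, (Z i).card ≤ w) →
      (∀ S : Finset V, S.Nonempty → (I.filter fun i => S ⊆ Z i).card * r ^ S.card ≤ H) →
      H * 2 ^ (w + 1) ≤ I.card * 2 ^ (w + 1) + H →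
      2 ^ M * (univ.filter fun ω : Fin M → V → Fin (q + 1) =>
        ∀ i ∈ I, ¬ Z i ⊆ coverSet ω).card ≤
        4 ^ w * Fintype.card (Fin M → V → Fin (q + 1)) := by
  intro M
  induction M with
  | zero =>
    intro w I Z _ _ _
    rw [pow_zero, one_mul]
    exact (card_le_univ _).trans (Nat.le_mul_of_pos_left _ (by positivity))
  | succ M ih =>
    intro w I Z hw hsp hI
    rcases w with _ | w
    · have hne : I.Nonempty := by
        rw [← card_pos]
        by_contra h
        have : I.card = 0 := by omega
        rw [this] at hI
        omega
      obtain ⟨i, hi⟩ := hne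
      have hZ : Z i = ∅ := card_eq_zero.1 (Nat.le_zero.1 (hw i hi))
      have : (univ.filter fun ω : Fin (M + 1) → V → Fin (q + 1) =>
          ∀ i ∈ I, ¬ Z i ⊆ coverSet ω) = ∅ :=
        filter_eq_empty_iff.2 fun ω _ h => h i hi (by simp [hZ])
      simp [this]
    · set X := Fintype.card (V → Fin (q + 1)) with hX
      set Y := Fintype.card (Fin M → V → Fin (q + 1)) with hY
      have hXY : Fintype.card (Fin (M + 1) → V → Fin (q + 1)) = X * Y := by
        rw [hX, hY, Fintype.card_fun (α := Fin (M + 1)), Fintype.card_fun (α := Fin M)]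
        simp only [Fintype.card_fin]
        ring
      set stuck : (V → Fin (q + 1)) → Finset ι := fun x =>
        I.filter fun i => IsStuck I Z (w + 1) (zeroSet x) (Z i) with hstuck
      set c : (V → Fin (q + 1)) → ℕ := fun x =>
        (univ.filter fun ω : Fin M → V → Fin (q + 1) =>
          ∀ i ∈ I, ¬ Z i ⊆ zeroSet x ∪ coverSet ω).card with hc
      set bad : Finset (V → Fin (q + 1)) :=
        univ.filter fun x => H < (stuck x).card * 2 ^ (w + 2) with hbad
      have hc1 : ∀ x, 2 ^ M * c x ≤ 4 ^ (w + 1) * Y := by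
        intro x
        refine le_trans (Nat.mul_le_mul_left _ (card_le_card fun ω hω => ?_))
          (ih (w + 1) I Z hw hsp hI)
        simp only [mem_filter, mem_univ, true_and] at hω ⊢
        exact fun i hi h => hω i hi (h.trans subset_union_right)
      have hc2 : ∀ x ∉ bad, 2 ^ M * c x ≤ 4 ^ w * Y := by
        intro x hx
        simp only [hbad, mem_filter, mem_univ, true_and, not_lt] at hx
        have hg : ∀ i, ∃ j, i ∈ I \ stuck x →
            j ∈ I ∧ Z j ⊆ zeroSet x ∪ Z i ∧ (Z j \ zeroSet x).card ≤ w := by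
          intro i
          by_cases hi : i ∈ I \ stuck x
          · obtain ⟨hiI, his⟩ := mem_sdiff.1 hi
            by_cases hcard : (Z i).card = w + 1
            · have : ¬ IsStuck I Z (w + 1) (zeroSet x) (Z i) := fun h =>
                his (mem_filter.2 ⟨hiI, h⟩)
              simp only [IsStuck, hcard, true_and, not_forall, not_le] at this
              obtain ⟨j, hj, hjs, hjc⟩ := this
              exact ⟨j, fun _ => ⟨hj, hjs, by omega⟩⟩
            · refine ⟨i, fun _ => ⟨hiI, subset_union_right, ?_⟩⟩
              have := hw i hiI
              have := card_le_card (sdiff_subset : Z i \ zeroSet x ⊆ Z i)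
              omega
          · exact ⟨i, fun h => absurd h hi⟩
        choose g hg using hg
        have hsub : ∀ i ∈ I \ stuck x, Z (g i) \ zeroSet x ⊆ Z i := by
          intro i hi v hv
          obtain ⟨hv1, hv2⟩ := mem_sdiff.1 hv
          exact (mem_union.1 ((hg i hi).2.1 hv1)).resolve_left hv2
        have hcardI : (I \ stuck x).card + (stuck x).card = I.card :=
          card_sdiff_add_card_eq_card (filter_subset _ _)
        have key := ih w (I \ stuck x) (fun i => Z (g i) \ zeroSet x)
          (fun i hi => (hg i hi).2.2) ?_ ?_
        · refine le_trans (Nat.mul_le_mul_left _ (card_le_card fun ω hω => ?_)) key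
          simp only [mem_filter, mem_univ, true_and] at hω ⊢
          intro i hi h
          exact hω (g i) (hg i hi).1 (sdiff_le_iff.1 h)
        · intro S hS
          refine le_trans (Nat.mul_le_mul_right _ (card_le_card fun i hi => ?_)) (hsp S hS)
          simp only [mem_filter] at hi ⊢
          exact ⟨(mem_sdiff.1 hi.1).1, hi.2.trans (hsub i hi.1)⟩
        · rw [← hcardI] at hI
          have : (2 : ℕ) ^ (w + 2) = 2 * 2 ^ (w + 1) := by ring
          rw [this] at hx
          rw [show w + 1 + 1 = w + 2 from rfl, this] at hI
          nlinarith
      have hbadc : 4 * bad.card ≤ X := by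
        have hs := sum_card_isStuck_le (q := q) I Z hr (Nat.succ_pos w) hw hsp
        have h1 : bad.card * H ≤ 2 ^ (w + 2) * ∑ x, (stuck x).card := by
          calc bad.card * H = ∑ x ∈ bad, H := by simp
            _ ≤ ∑ x ∈ bad, (stuck x).card * 2 ^ (w + 2) :=
                sum_le_sum fun x hx => (mem_filter.1 hx).2.le
            _ ≤ ∑ x, (stuck x).card * 2 ^ (w + 2) :=
                sum_le_sum_of_subset (subset_univ _)
            _ = _ := by rw [← sum_mul, mul_comm]
        have h2 : 4 * 2 ^ (w + 2) ≤ 16 ^ (w + 1) := by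
          have : (2 : ℕ) ^ w ≤ 16 ^ w := Nat.pow_le_pow_left (by norm_num) w
          rw [pow_add, pow_succ 16]
          omega
        have h3 : (4 * bad.card) * H ≤ X * H := by
          calc (4 * bad.card) * H = 4 * (bad.card * H) := by ring
            _ ≤ 4 * (2 ^ (w + 2) * ∑ x, (stuck x).card) := by gcongr
            _ = (4 * 2 ^ (w + 2)) * ∑ x, (stuck x).card := by ring
            _ ≤ 16 ^ (w + 1) * ∑ x, (stuck x).card := by gcongr
            _ ≤ H * X := hs
            _ = X * H := mul_comm _ _
        exact Nat.le_of_mul_le_mul_right h3 hH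
      have hsplit : (univ.filter fun ω : Fin (M + 1) → V → Fin (q + 1) =>
          ∀ i ∈ I, ¬ Z i ⊆ coverSet ω).card = ∑ x, c x := by
        rw [card_filter_fin_cons]
        simp only [hc, coverSet_cons]
      rw [hsplit, hXY]
      have hsum : 2 ^ M * ∑ x, c x ≤ bad.card * (4 ^ (w + 1) * Y) + X * (4 ^ w * Y) := by
        rw [mul_sum]
        calc ∑ x, 2 ^ M * c x
            ≤ ∑ x : V → Fin (q + 1), ((if x ∈ bad then 4 ^ (w + 1) * Y else 0) + 4 ^ w * Y) := by
              refine sum_le_sum fun x _ => ?_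
              by_cases hx : x ∈ bad
              · rw [if_pos hx]; exact (hc1 x).trans (Nat.le_add_right _ _)
              · rw [if_neg hx, zero_add]; exact hc2 x hx
          _ = _ := by
              rw [sum_add_distrib, sum_ite_mem, univ_inter]
              simp [hX]
      calc 2 ^ (M + 1) * ∑ x, c x = 2 * (2 ^ M * ∑ x, c x) := by ring
        _ ≤ 2 * (bad.card * (4 ^ (w + 1) * Y) + X * (4 ^ w * Y)) := by gcongr
        _ = 2 * ((4 * bad.card) * (4 ^ w * Y) + X * (4 ^ w * Y)) := by ring
        _ ≤ 2 * (X * (4 ^ w * Y) + X * (4 ^ w * Y)) := by gcongr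
        _ = 4 ^ (w + 1) * (X * Y) := by ring

theorem card_label_eq_zero {q M : ℕ} (b : Fin M) (v : V) :
    (q + 1) * (univ.filter fun ω : Fin M → V → Fin (q + 1) => ω b v = 0).card =
      Fintype.card (Fin M → V → Fin (q + 1)) := by
  have h : ∀ a : Fin (q + 1), (univ.filter fun ω : Fin M → V → Fin (q + 1) => ω b v = a).card =
      (univ.filter fun ω : Fin M → V → Fin (q + 1) => ω b v = 0).card := by
    intro a
    refine card_equiv (Equiv.subRight fun _ _ => a) fun ω => ?_
    simp [sub_eq_zero]
  have := card_eq_sum_card_fiberwise (f := fun ω : Fin M → V → Fin (q + 1) => ω b v)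
    (s := univ) (t := univ) (by simp)
  simp only [h, sum_const, card_univ, Fintype.card_fin, smul_eq_mul] at this
  exact this.symm

theorem card_small_coverSet {q M : ℕ} (hM : 4 * M ≤ q + 1) (n : ℕ) (hn : 0 < n)
    (hV : Fintype.card V = 2 * n) :
    Fintype.card (Fin M → V → Fin (q + 1)) ≤
      2 * (univ.filter fun ω : Fin M → V → Fin (q + 1) => (coverSet ω).card < n).card := by
  set T := Fintype.card (Fin M → V → Fin (q + 1)) with hT
  have h1 : (q + 1) * ∑ ω : Fin M → V → Fin (q + 1), (coverSet ω).card ≤ M * (2 * n) * T := by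
    calc (q + 1) * ∑ ω : Fin M → V → Fin (q + 1), (coverSet ω).card
        ≤ (q + 1) * ∑ ω : Fin M → V → Fin (q + 1), ∑ b : Fin M, ∑ v : V,
            if ω b v = 0 then 1 else 0 := by
          gcongr with ω
          have : coverSet ω = univ.biUnion fun b => univ.filter fun v => ω b v = 0 := by
            ext v; simp [coverSet]
          rw [this]
          refine card_biUnion_le.trans (sum_le_sum fun b _ => ?_)
          rw [card_filter]
      _ = ∑ b : Fin M, ∑ v : V, (q + 1) *
            (univ.filter fun ω : Fin M → V → Fin (q + 1) => ω b v = 0).card := by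
          rw [sum_comm, mul_sum]
          refine sum_congr rfl fun b _ => ?_
          rw [sum_comm, mul_sum]
          refine sum_congr rfl fun v _ => ?_
          rw [card_filter]
      _ = M * (2 * n) * T := by
          simp only [card_label_eq_zero, sum_const, card_univ, hV, Fintype.card_fin, smul_eq_mul]
          ring
  have h2 : (univ.filter fun ω : Fin M → V → Fin (q + 1) => ¬ (coverSet ω).card < n).card * n ≤
      ∑ ω : Fin M → V → Fin (q + 1), (coverSet ω).card := by
    rw [← smul_eq_mul, ← sum_const]
    refine (sum_le_sum fun ω hω => ?_).trans (sum_le_sum_of_subset (subset_univ _))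
    exact not_lt.1 (mem_filter.1 hω).2
  have h3 := card_filter_add_card_filter_not (s := univ)
    (fun ω : Fin M → V → Fin (q + 1) => (coverSet ω).card < n)
  rw [card_univ, ← hT] at h3
  set B := (univ.filter fun ω : Fin M → V → Fin (q + 1) => ¬ (coverSet ω).card < n).card
  have h4 : (q + 1) * n * (2 * B) ≤ (q + 1) * n * T := by
    calc (q + 1) * n * (2 * B) = 2 * ((q + 1) * (B * n)) := by ring
      _ ≤ 2 * ((q + 1) * ∑ ω : Fin M → V → Fin (q + 1), (coverSet ω).card) := by gcongr
      _ ≤ 2 * (M * (2 * n) * T) := by gcongr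
      _ = 4 * M * (n * T) := by ring
      _ ≤ (q + 1) * (n * T) := by gcongr
      _ = (q + 1) * n * T := by ring
  have := Nat.le_of_mul_le_mul_left h4 (by positivity)
  omega

end SpreadFamilies

section CircuitErrors

open Finset
open scoped Classical

variable {ι α Ω : Type} [Fintype Ω]

/-- Evaluation of a monotone circuit in an arbitrary algebra with two binary operations. -/
def MonCircuit.interp (C : MonCircuit ι) (leaf : ι → α) (conj disj : α → α → α) :
    (i : Fin C.size) → α
  | i =>
    match C.gate i with
    | Sum.inl j => leaf j
    | Sum.inr (op, j, k) =>
      let a := C.interp leaf conj disj ⟨j.val, j.isLt.trans i.isLt⟩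
      let b := C.interp leaf conj disj ⟨k.val, k.isLt.trans i.isLt⟩
      if op then conj a b else disj a b
  termination_by i => i.val

/-- If every operation of an approximate interpretation of the circuit introduces at most `B`
errors of a kind `Err` that propagates through the gates, then the interpretation has at most
`size * B` errors. -/
theorem MonCircuit.card_error_le (C : MonCircuit ι) (leaf : ι → α) (conj disj : α → α → α)
    (P : α → Prop) (acc : α → Ω → Prop) (x : Ω → ι → Bool) (Err : Prop → Prop → Prop)
    (hirr : ∀ p, ¬ Err p p)
    (htri : ∀ p q s, Err p s → Err p q ∨ Err q s)
    (hand : ∀ p q p' q', Err (p ∧ q) (p' ∧ q') → Err p p' ∨ Err q q')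
    (hor : ∀ p q p' q', Err (p ∨ q) (p' ∨ q') → Err p p' ∨ Err q q')
    (B : ℝ)
    (hleaf : ∀ e, P (leaf e) ∧
      ∀ D : Finset Ω, (∀ ω ∈ D, Err (acc (leaf e) ω) (x ω e = true)) → (D.card : ℝ) ≤ B)
    (hconj : ∀ a b, P a → P b → P (conj a b) ∧
      ∀ D : Finset Ω, (∀ ω ∈ D, Err (acc (conj a b) ω) (acc a ω ∧ acc b ω)) → (D.card : ℝ) ≤ B)
    (hdisj : ∀ a b, P a → P b → P (disj a b) ∧
      ∀ D : Finset Ω, (∀ ω ∈ D, Err (acc (disj a b) ω) (acc a ω ∨ acc b ω)) → (D.card : ℝ) ≤ B)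
    (i : Fin C.size) :
    P (C.interp leaf conj disj i) ∧
      ∀ D : Finset Ω,
        (∀ ω ∈ D, Err (acc (C.interp leaf conj disj i) ω) (C.eval (x ω) i = true)) →
          (D.card : ℝ) ≤ C.size * B := by
  have step : ∃ D : Fin C.size → Finset Ω, (∀ j, ((D j).card : ℝ) ≤ B) ∧
      ∀ m (hm : m < C.size), P (C.interp leaf conj disj ⟨m, hm⟩) ∧
        ∀ ω, Err (acc (C.interp leaf conj disj ⟨m, hm⟩) ω) (C.eval (x ω) ⟨m, hm⟩ = true) →
          ∃ j, ω ∈ D j := by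
    let I := C.interp leaf conj disj
    have hP : ∀ m (hm : m < C.size), P (I ⟨m, hm⟩) := by
      intro m
      induction m using Nat.strong_induction_on with
      | _ m ih =>
        intro hm
        simp only [I]
        rw [MonCircuit.interp]
        rcases hg : C.gate ⟨m, hm⟩ with e | ⟨op, j, k⟩
        · exact (hleaf e).1
        · have hj := ih j.val j.isLt (j.isLt.trans hm)
          have hk := ih k.val k.isLt (k.isLt.trans hm)
          cases op
          · exact (hdisj _ _ hj hk).1
          · exact (hconj _ _ hj hk).1
    let loc : Fin C.size → Ω → Prop := fun i ω =>
      match C.gate i with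
      | Sum.inl e => x ω e = true
      | Sum.inr (op, j, k) =>
        if op then acc (I ⟨j.val, j.isLt.trans i.isLt⟩) ω ∧ acc (I ⟨k.val, k.isLt.trans i.isLt⟩) ω
        else acc (I ⟨j.val, j.isLt.trans i.isLt⟩) ω ∨ acc (I ⟨k.val, k.isLt.trans i.isLt⟩) ω
    refine ⟨fun j => univ.filter fun ω => Err (acc (I j) ω) (loc j ω), ?_, ?_⟩
    · rintro ⟨m, hm⟩
      suffices hloc : ∀ D : Finset Ω, (∀ ω ∈ D, Err (acc (I ⟨m, hm⟩) ω) (loc ⟨m, hm⟩ ω)) →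
          (D.card : ℝ) ≤ B from hloc _ fun ω hω => (mem_filter.1 hω).2
      intro D
      simp only [I, loc]
      rw [MonCircuit.interp]
      rcases hg : C.gate ⟨m, hm⟩ with e | ⟨op, j, k⟩
      · exact (hleaf e).2 D
      · have hj := hP j.val (j.isLt.trans hm)
        have hk := hP k.val (k.isLt.trans hm)
        cases op
        · simpa using (hdisj _ _ hj hk).2 D
        · simpa using (hconj _ _ hj hk).2 D
    · intro m
      induction m using Nat.strong_induction_on with
      | _ m ih =>
        intro hm
        refine ⟨hP m hm, fun ω hω => ?_⟩
        rcases htri _ (loc ⟨m, hm⟩ ω) _ hω with h | h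
        · exact ⟨⟨m, hm⟩, by simpa using h⟩
        · rw [MonCircuit.eval] at h
          simp only [loc] at h
          rcases hg : C.gate ⟨m, hm⟩ with e | ⟨op, j, k⟩
          · rw [hg] at h
            exact absurd h (hirr _)
          · rw [hg] at h
            have hj := (ih j.val j.isLt (j.isLt.trans hm)).2 ω
            have hk := (ih k.val k.isLt (k.isLt.trans hm)).2 ω
            cases op
            · simp only [Bool.false_eq_true, if_false, Bool.or_eq_true] at h
              exact (hor _ _ _ _ h).elim hj hk
            · simp only [if_true, Bool.and_eq_true] at h
              exact (hand _ _ _ _ h).elim hj hk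
  obtain ⟨D, hD, hI⟩ := step
  refine ⟨(hI i.val i.isLt).1, fun E hE => ?_⟩
  have hsub : E ⊆ univ.biUnion D := by
    intro ω hω
    simpa using (hI i.val i.isLt).2 ω (hE ω hω)
  calc _ ≤ ((univ.biUnion D).card : ℝ) := by exact_mod_cast card_le_card hsub
    _ ≤ ∑ j, ((D j).card : ℝ) := by exact_mod_cast card_biUnion_le
    _ ≤ ∑ j : Fin C.size, B := sum_le_sum fun j _ => hD j
    _ = C.size * B := by simp

end CircuitErrors

section MatchingFamilies

open Finset
open scoped Classical

variable {n M q w : ℕ}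

theorem IsMatching.mono {F K : Finset (Fin n × Fin n)} (hF : IsMatching F) (h : K ⊆ F) :
    IsMatching K := fun e he e' he' hne => hF e (h he) e' (h he') hne

theorem IsMatching.eq_of_fst_eq {F : Finset (Fin n × Fin n)} (hF : IsMatching F)
    {e e' : Fin n × Fin n} (he : e ∈ F) (he' : e' ∈ F) (h : e.1 = e'.1) : e = e' := by
  by_contra hne
  exact (hF e he e' he' hne).1 h

theorem IsMatching.eq_of_snd_eq {F : Finset (Fin n × Fin n)} (hF : IsMatching F)
    {e e' : Fin n × Fin n} (he : e ∈ F) (he' : e' ∈ F) (h : e.2 = e'.2) : e = e' := by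
  by_contra hne
  exact (hF e he e' he' hne).2 h

/-- The matchings with at most `w` edges. -/
noncomputable def smallMatchings (n w : ℕ) : Finset (Finset (Fin n × Fin n)) :=
  univ.filter fun K => IsMatching K ∧ K.card ≤ w

theorem mem_smallMatchings {K : Finset (Fin n × Fin n)} :
    K ∈ smallMatchings n w ↔ IsMatching K ∧ K.card ≤ w := by
  simp [smallMatchings]

/-- The edges with at least one endpoint in `Y`. -/
def Touches (Y : Finset (Fin n ⊕ Fin n)) (e : Fin n × Fin n) : Prop :=
  Sum.inl e.1 ∈ Y ∨ Sum.inr e.2 ∈ Y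

/-- Some member of `A` consists of edges satisfying `P`. -/
def Accepts (A : Finset (Finset (Fin n × Fin n))) (P : Fin n × Fin n → Prop) : Prop :=
  ∃ F ∈ A, ∀ e ∈ F, P e

/-- The outcomes whose graph, together with `K`, is not accepted by `A`. -/
noncomputable def missSet (M q : ℕ) (A : Finset (Finset (Fin n × Fin n)))
    (K : Finset (Fin n × Fin n)) : Finset (Fin M → Fin n ⊕ Fin n → Fin (q + 1)) :=
  univ.filter fun ω => ¬ Accepts A fun e => e ∈ K ∨ Touches (coverSet ω) e

/-- A family of small matchings containing every small matching that it almost implies. -/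
def RobustlyClosed (M q w : ℕ) (A : Finset (Finset (Fin n × Fin n))) : Prop :=
  A ⊆ smallMatchings n w ∧ ∀ K ∈ smallMatchings n w,
    2 ^ M * (missSet M q A K).card ≤
      4 ^ w * Fintype.card (Fin M → Fin n ⊕ Fin n → Fin (q + 1)) → K ∈ A

theorem missSet_anti {A B : Finset (Finset (Fin n × Fin n))} (h : A ⊆ B)
    (K : Finset (Fin n × Fin n)) : missSet M q B K ⊆ missSet M q A K := by
  intro ω hω
  simp only [missSet, mem_filter, mem_univ, true_and] at hω ⊢
  exact fun ⟨F, hF, h'⟩ => hω ⟨F, h hF, h'⟩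

theorem RobustlyClosed.inter {A B : Finset (Finset (Fin n × Fin n))}
    (hA : RobustlyClosed M q w A) (hB : RobustlyClosed M q w B) :
    RobustlyClosed M q w (A ∩ B) := by
  refine ⟨inter_subset_left.trans hA.1, fun K hK h => mem_inter.2 ⟨hA.2 K hK ?_, hB.2 K hK ?_⟩⟩
  · exact (Nat.mul_le_mul_left _ (card_le_card (missSet_anti inter_subset_left K))).trans h
  · exact (Nat.mul_le_mul_left _ (card_le_card (missSet_anti inter_subset_right K))).trans h

theorem RobustlyClosed.mem_of_superset {A : Finset (Finset (Fin n × Fin n))}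
    (hA : RobustlyClosed M q w A) {F K : Finset (Fin n × Fin n)} (hF : F ∈ A) (h : F ⊆ K)
    (hK : K ∈ smallMatchings n w) : K ∈ A := by
  refine hA.2 K hK ?_
  have : missSet M q A K = ∅ :=
    filter_eq_empty_iff.2 fun ω _ hω => hω ⟨F, hF, fun e he => Or.inl (h he)⟩
  simp [this]

theorem exists_robustlyClosed (M q w : ℕ) (A : Finset (Finset (Fin n × Fin n)))
    (hA : A ⊆ smallMatchings n w) :
    ∃ B, A ⊆ B ∧ RobustlyClosed M q w B ∧
      2 ^ M * (univ.filter fun ω : Fin M → Fin n ⊕ Fin n → Fin (q + 1) =>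
        Accepts B (Touches (coverSet ω)) ∧ ¬ Accepts A (Touches (coverSet ω))).card ≤
      (smallMatchings n w \ A).card *
        (4 ^ w * Fintype.card (Fin M → Fin n ⊕ Fin n → Fin (q + 1))) := by
  induction hm : (smallMatchings n w \ A).card generalizing A with
  | zero =>
    refine ⟨A, Subset.rfl, ⟨hA, fun K hK _ => ?_⟩, by simp⟩
    by_contra h
    have := card_pos.2 ⟨K, mem_sdiff.2 ⟨hK, h⟩⟩
    omega
  | succ m ih =>
    by_cases hcl : RobustlyClosed M q w A
    · exact ⟨A, Subset.rfl, hcl, by simp⟩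
    · simp only [RobustlyClosed, hA, true_and, not_forall] at hcl
      obtain ⟨K, hK, hmiss, hKA⟩ := hcl
      have hcard : (smallMatchings n w \ insert K A).card = m := by
        rw [sdiff_insert, card_erase_of_mem (mem_sdiff.2 ⟨hK, hKA⟩), hm]
        rfl
      obtain ⟨B, hAB, hB, hBc⟩ := ih (insert K A) (insert_subset hK hA) hcard
      refine ⟨B, (subset_insert K A).trans hAB, hB, ?_⟩
      have hsub : (univ.filter fun ω : Fin M → Fin n ⊕ Fin n → Fin (q + 1) =>
          Accepts B (Touches (coverSet ω)) ∧ ¬ Accepts A (Touches (coverSet ω))) ⊆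
          (univ.filter fun ω : Fin M → Fin n ⊕ Fin n → Fin (q + 1) =>
            Accepts B (Touches (coverSet ω)) ∧ ¬ Accepts (insert K A) (Touches (coverSet ω))) ∪
            missSet M q A K := by
        intro ω hω
        simp only [missSet, mem_union, mem_filter, mem_univ, true_and] at hω ⊢
        by_cases h : Accepts (insert K A) (Touches (coverSet ω))
        · right
          obtain ⟨F, hF, hFω⟩ := h
          rcases mem_insert.1 hF with rfl | hF
          · rintro ⟨G, hG, hGω⟩
            exact hω.2 ⟨G, hG, fun e he => (hGω e he).elim (hFω e) id⟩
          · exact absurd ⟨F, hF, hFω⟩ hω.2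
        · exact Or.inl ⟨hω.1, h⟩
      calc _ ≤ 2 ^ M * (_ + (missSet M q A K).card) :=
            Nat.mul_le_mul_left _ ((card_le_card hsub).trans (card_union_le _ _))
        _ ≤ m * (4 ^ w * Fintype.card (Fin M → Fin n ⊕ Fin n → Fin (q + 1))) +
            4 ^ w * Fintype.card (Fin M → Fin n ⊕ Fin n → Fin (q + 1)) := by
            rw [mul_add]
            exact add_le_add hBc hmiss
        _ = _ := by ring

theorem card_smallMatchings_le (n w : ℕ) : (smallMatchings n w).card ≤ (n * n + 1) ^ w := by
  have hgeom : ∀ m w : ℕ, ∑ k ∈ range (w + 1), m ^ k ≤ (m + 1) ^ w := by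
    intro m w
    induction w with
    | zero => simp
    | succ w ih =>
      rw [sum_range_succ]
      have : m ^ w ≤ (m + 1) ^ w := Nat.pow_le_pow_left (Nat.le_succ m) w
      calc _ ≤ (m + 1) ^ w + (m + 1) ^ w * m := by
            rw [pow_succ]; gcongr
        _ = (m + 1) ^ (w + 1) := by ring
  have hsub : smallMatchings n w ⊆
      (range (w + 1)).biUnion fun k => powersetCard k (univ : Finset (Fin n × Fin n)) := by
    intro K hK
    have := (mem_smallMatchings.1 hK).2
    simp only [mem_biUnion, mem_range, mem_powersetCard, subset_univ, true_and]
    exact ⟨K.card, by omega, rfl⟩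
  refine (card_le_card hsub).trans (card_biUnion_le.trans (le_trans (sum_le_sum fun k _ => ?_)
    (hgeom (n * n) w)))
  rw [card_powersetCard]
  simpa using Nat.choose_le_pow (n * n) k

/-- The inclusion-minimal members of `A` with exactly `k` edges. -/
noncomputable def minimalOfCard (A : Finset (Finset (Fin n × Fin n))) (k : ℕ) :
    Finset (Finset (Fin n × Fin n)) :=
  A.filter fun F => F.card = k ∧ ∀ K ∈ A, K ⊆ F → K = F

/-- The members of `𝒜` that contain `K` and match every vertex of `U` by an edge outside `K`. -/
noncomputable def starLink (𝒜 : Finset (Finset (Fin n × Fin n)))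
    (K : Finset (Fin n × Fin n)) (U : Finset (Fin n)) : Finset (Finset (Fin n × Fin n)) :=
  𝒜.filter fun F => K ⊆ F ∧ U ⊆ (F \ K).image Prod.snd

/-- The endpoint of an edge that is used to cover it: the left one iff the right one is in `U`. -/
def coverEnd (U : Finset (Fin n)) (e : Fin n × Fin n) : Fin n ⊕ Fin n :=
  if e.2 ∈ U then Sum.inl e.1 else Sum.inr e.2

/-- The covering endpoints of a weight-maximal link form a spread family. -/
theorem card_coverEnd_le {𝒜 : Finset (Finset (Fin n × Fin n))} {r : ℕ} (hr : 0 < r) (hw : 0 < w)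
    (h𝒜 : ∀ F ∈ 𝒜, IsMatching F) (K : Finset (Fin n × Fin n)) (U : Finset (Fin n))
    (hU : U.card ≤ w)
    (hmax : ∀ K' U', (starLink 𝒜 K' U').card * (w * r ^ 2) ^ K'.card * r ^ U'.card ≤
      (starLink 𝒜 K U).card * (w * r ^ 2) ^ K.card * r ^ U.card)
    (S : Finset (Fin n ⊕ Fin n)) :
    ((starLink 𝒜 K U).filter fun F => S ⊆ (F \ K).image (coverEnd U)).card * r ^ S.card ≤
      (starLink 𝒜 K U).card := by
  set a := S.toLeft with ha
  set b := S.toRight with hb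
  have hab : S.card = a.card + b.card := (card_toLeft_add_card_toRight).symm
  let T : (a → U) → Finset (Fin n × Fin n) := fun φ => univ.image fun u => (u.1, (φ u).1)
  let 𝓑 : (a → U) → Finset (Finset (Fin n × Fin n)) := fun φ =>
    (starLink 𝒜 K U).filter fun F => T φ ⊆ F \ K ∧ S ⊆ (F \ K).image (coverEnd U)
  have hcov : ((starLink 𝒜 K U).filter fun F => S ⊆ (F \ K).image (coverEnd U)) ⊆
      univ.biUnion 𝓑 := by
    intro F hF
    obtain ⟨hF1, hF2⟩ := mem_filter.1 hF
    have : ∀ u : a, ∃ v : U, (u.1, v.1) ∈ F \ K := by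
      rintro ⟨u, hu⟩
      have hu' : Sum.inl u ∈ S := mem_toLeft.1 hu
      obtain ⟨e, he, heu⟩ := mem_image.1 (hF2 hu')
      by_cases heU : e.2 ∈ U
      · simp only [coverEnd, heU, if_true, Sum.inl.injEq] at heu
        exact ⟨⟨e.2, heU⟩, by simpa [← heu] using he⟩
      · simp [coverEnd, heU] at heu
    choose φ hφ using this
    refine mem_biUnion.2 ⟨φ, mem_univ _, mem_filter.2 ⟨hF1, ?_, hF2⟩⟩
    intro e he
    obtain ⟨u, _, rfl⟩ := mem_image.1 he
    exact hφ u
  have hbd : ∀ φ, (𝓑 φ).card * (w ^ a.card * r ^ S.card) ≤ (starLink 𝒜 K U).card := by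
    intro φ
    rcases (𝓑 φ).eq_empty_or_nonempty with h | ⟨F₀, hF₀⟩
    · simp [h]
    · set ran : Finset (Fin n) := univ.image fun u => (φ u).1 with hran
      obtain ⟨hF₀1, hF₀T, hF₀S⟩ := mem_filter.1 hF₀
      have hF₀m : IsMatching F₀ := h𝒜 F₀ (mem_filter.1 hF₀1).1
      have hmemT : ∀ u, (u.1, (φ u).1) ∈ T φ := fun u => mem_image_of_mem _ (mem_univ u)
      have hTc : (T φ).card = a.card := by
        rw [card_image_of_injective _ fun u u' h => Subtype.ext (Prod.ext_iff.1 h).1]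
        simp
      have hranc : ran.card = a.card := by
        rw [hran, card_image_of_injective]
        · simp
        · intro u u' h
          have := hF₀m.eq_of_snd_eq (mem_sdiff.1 (hF₀T (hmemT u))).1
            (mem_sdiff.1 (hF₀T (hmemT u'))).1 h
          exact Subtype.ext (Prod.ext_iff.1 this).1
      have hranU : ran ⊆ U := by
        intro v hv
        obtain ⟨u, _, rfl⟩ := mem_image.1 hv
        exact (φ u).2
      have hbsnd : ∀ F, S ⊆ (F \ K).image (coverEnd U) → ∀ v ∈ b,
          v ∉ U ∧ ∃ e ∈ F \ K, e.2 = v := by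
        intro F hF v hv
        obtain ⟨e, he, hev⟩ := mem_image.1 (hF (mem_toRight.1 hv))
        by_cases heU : e.2 ∈ U
        · simp [coverEnd, heU] at hev
        · simp only [coverEnd, heU, if_false, Sum.inr.injEq] at hev
          exact ⟨hev ▸ heU, e, he, hev⟩
      have hKc : (K ∪ T φ).card = K.card + a.card := by
        rw [card_union_of_disjoint, hTc]
        exact disjoint_left.2 fun e he he' => (mem_sdiff.1 (hF₀T he')).2 he
      have hUc : (U \ ran ∪ b).card + a.card = U.card + b.card := by
        rw [card_union_of_disjoint, ← hranc]
        · have := card_sdiff_add_card_eq_card hranU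
          omega
        · exact disjoint_left.2 fun v hv hv' =>
            (hbsnd F₀ hF₀S v hv').1 (mem_sdiff.1 hv).1
      have hsub : 𝓑 φ ⊆ starLink 𝒜 (K ∪ T φ) (U \ ran ∪ b) := by
        intro F hF
        obtain ⟨hF1, hFT, hFS⟩ := mem_filter.1 hF
        obtain ⟨hFA, hKF, hUF⟩ := mem_filter.1 hF1
        have hTran : ∀ e ∈ T φ, e.2 ∈ ran := by
          intro e he
          obtain ⟨u, _, rfl⟩ := mem_image.1 he
          exact mem_image_of_mem _ (mem_univ u)
        refine mem_filter.2 ⟨hFA, union_subset hKF (hFT.trans sdiff_subset), ?_⟩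
        intro v hv
        rcases mem_union.1 hv with hv | hv
        · obtain ⟨hvU, hvr⟩ := mem_sdiff.1 hv
          obtain ⟨e, he, rfl⟩ := mem_image.1 (hUF hvU)
          obtain ⟨he1, he2⟩ := mem_sdiff.1 he
          refine mem_image_of_mem _ (mem_sdiff.2 ⟨he1, fun h => ?_⟩)
          exact (mem_union.1 h).elim he2 fun h => hvr (hTran e h)
        · obtain ⟨hvU, e, he, rfl⟩ := hbsnd F hFS v hv
          obtain ⟨he1, he2⟩ := mem_sdiff.1 he
          refine mem_image_of_mem _ (mem_sdiff.2 ⟨he1, fun h => ?_⟩)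
          exact (mem_union.1 h).elim he2 fun h => hvU (hranU (hTran e h))
      have h1 := hmax (K ∪ T φ) (U \ ran ∪ b)
      have h2 := card_le_card hsub
      rw [hKc] at h1
      have h3 : r ^ (U \ ran ∪ b).card * r ^ a.card = r ^ U.card * r ^ b.card := by
        rw [← pow_add, ← pow_add, hUc]
      have hpos : 0 < (w * r ^ 2) ^ K.card * r ^ U.card * r ^ a.card := by positivity
      refine Nat.le_of_mul_le_mul_right ?_ hpos
      calc (𝓑 φ).card * (w ^ a.card * r ^ S.card) *
            ((w * r ^ 2) ^ K.card * r ^ U.card * r ^ a.card)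
          = (𝓑 φ).card * (w * r ^ 2) ^ (K.card + a.card) * (r ^ U.card * r ^ b.card) := by
            rw [hab]; ring
        _ ≤ (starLink 𝒜 (K ∪ T φ) (U \ ran ∪ b)).card * (w * r ^ 2) ^ (K.card + a.card) *
            (r ^ U.card * r ^ b.card) := by gcongr
        _ = (starLink 𝒜 (K ∪ T φ) (U \ ran ∪ b)).card * (w * r ^ 2) ^ (K.card + a.card) *
            r ^ (U \ ran ∪ b).card * r ^ a.card := by rw [← h3]; ring
        _ ≤ (starLink 𝒜 K U).card * (w * r ^ 2) ^ K.card * r ^ U.card * r ^ a.card := by gcongr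
        _ = _ := by ring
  have hwpos : 0 < w ^ a.card := by positivity
  refine Nat.le_of_mul_le_mul_right ?_ hwpos
  calc _ ≤ (∑ φ, (𝓑 φ).card) * r ^ S.card * w ^ a.card := by
        gcongr
        exact (card_le_card hcov).trans card_biUnion_le
    _ = ∑ φ, (𝓑 φ).card * (w ^ a.card * r ^ S.card) := by
        rw [sum_mul, sum_mul]
        exact sum_congr rfl fun φ _ => by ring
    _ ≤ ∑ φ : a → U, (starLink 𝒜 K U).card := sum_le_sum fun φ _ => hbd φ
    _ = U.card ^ a.card * (starLink 𝒜 K U).card := by simp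
    _ ≤ w ^ a.card * (starLink 𝒜 K U).card := by gcongr
    _ = _ := mul_comm _ _

theorem RobustlyClosed.card_minimalOfCard_le {A : Finset (Finset (Fin n × Fin n))} {r k : ℕ}
    (hA : RobustlyClosed M q w A) (hr : 16 * (q + 1) ≤ r) (hw : 0 < w) :
    (minimalOfCard A k).card ≤ (w * r ^ 2) ^ k := by
  by_contra hlt
  rw [not_le] at hlt
  set 𝒜 := minimalOfCard A k with h𝒜
  have hmin : ∀ F ∈ 𝒜, F ∈ A ∧ F.card = k ∧ ∀ K ∈ A, K ⊆ F → K = F := fun F hF => by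
    simpa [h𝒜, minimalOfCard] using hF
  have hsmall : ∀ F ∈ 𝒜, IsMatching F ∧ F.card ≤ w := fun F hF =>
    mem_smallMatchings.1 (hA.1 (hmin F hF).1)
  obtain ⟨⟨K, U⟩, -, hmax⟩ := exists_max_image
    (univ : Finset (Finset (Fin n × Fin n) × Finset (Fin n)))
    (fun p => (starLink 𝒜 p.1 p.2).card * (w * r ^ 2) ^ p.1.card * r ^ p.2.card)
    univ_nonempty
  replace hmax : ∀ K' U', (starLink 𝒜 K' U').card * (w * r ^ 2) ^ K'.card * r ^ U'.card ≤
      (starLink 𝒜 K U).card * (w * r ^ 2) ^ K.card * r ^ U.card :=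
    fun K' U' => hmax (K', U') (mem_univ _)
  have hbig : (w * r ^ 2) ^ k < (starLink 𝒜 K U).card * (w * r ^ 2) ^ K.card * r ^ U.card := by
    refine hlt.trans_le (le_trans ?_ (hmax ∅ ∅))
    simp [starLink]
  have hne : (starLink 𝒜 K U).Nonempty := by
    rw [nonempty_iff_ne_empty]
    intro h
    simp [h] at hbig
  have hproper : ∀ F ∈ starLink 𝒜 K U, K ≠ F := by
    rintro F hF rfl
    obtain ⟨hF1, -, hF3⟩ := mem_filter.1 hF
    have hU : U = ∅ := by simpa using hF3
    have h1 : starLink 𝒜 K U ⊆ {K} := by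
      intro G hG
      obtain ⟨hG1, hG2, -⟩ := mem_filter.1 hG
      rw [mem_singleton]
      exact ((hmin G hG1).2.2 K (hmin K hF1).1 hG2).symm
    have h2 := card_le_card h1
    rw [(hmin K hF1).2.1, hU, card_empty, pow_zero, mul_one, ← hU] at hbig
    rw [card_singleton] at h2
    nlinarith [Nat.zero_le ((w * r ^ 2) ^ k)]
  obtain ⟨F₀, hF₀⟩ := hne
  obtain ⟨hF₀1, hF₀2, hF₀3⟩ := mem_filter.1 hF₀
  have hUw : U.card ≤ w :=
    (card_le_card hF₀3).trans (card_image_le.trans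
      ((card_le_card sdiff_subset).trans (hsmall F₀ hF₀1).2))
  have hKsmall : K ∈ smallMatchings n w := mem_smallMatchings.2
    ⟨(hsmall F₀ hF₀1).1.mono hF₀2, (card_le_card hF₀2).trans (hsmall F₀ hF₀1).2⟩
  refine hproper F₀ hF₀ ((hmin F₀ hF₀1).2.2 K (hA.2 K hKsmall ?_) hF₀2)
  have hspread := card_coverEnd_le (by omega) hw (fun F hF => (hsmall F hF).1) K U hUw hmax
  have key := card_not_covered_le (V := Fin n ⊕ Fin n) (q := q) (r := r) hr
    (card_pos.2 ⟨F₀, hF₀⟩) M w (starLink 𝒜 K U) (fun F => (F \ K).image (coverEnd U))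
    (fun F hF => card_image_le.trans ((card_le_card sdiff_subset).trans
      (hsmall F (mem_filter.1 hF).1).2))
    (fun S _ => hspread S)
    le_self_add
  refine le_trans (Nat.mul_le_mul_left _ (card_le_card fun ω hω => ?_)) key
  simp only [missSet, mem_filter, mem_univ, true_and] at hω ⊢
  intro F hF hcov
  refine hω ⟨F, (hmin F (mem_filter.1 hF).1).1, fun e he => ?_⟩
  by_cases heK : e ∈ K
  · exact Or.inl heK
  · right
    have := hcov (mem_image_of_mem (coverEnd U) (mem_sdiff.2 ⟨he, heK⟩))
    unfold coverEnd at this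
    split_ifs at this
    · exact Or.inl this
    · exact Or.inr this

end MatchingFamilies

section PerfectMatchings

open Finset
open scoped Classical Nat

variable {n M q w : ℕ}

theorem card_perm_extending_le (F : Finset (Fin n × Fin n)) (hF : IsMatching F)
    (hn : 2 * F.card ≤ n) :
    (univ.filter fun σ : Equiv.Perm (Fin n) => ∀ e ∈ F, σ e.1 = e.2).card * n ^ F.card ≤
      2 ^ F.card * n ! := by
  induction F using Finset.induction_on with
  | empty => simp [Fintype.card_perm]
  | insert e F he ih =>
    rw [card_insert_of_notMem he] at hn ⊢
    have hF' : IsMatching F := hF.mono (subset_insert e F)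
    have ih' := ih hF' (by omega)
    set c := (univ.filter fun σ : Equiv.Perm (Fin n) => ∀ d ∈ F, σ d.1 = d.2) with hc
    set c' := (univ.filter fun σ : Equiv.Perm (Fin n) => ∀ d ∈ insert e F, σ d.1 = d.2) with hc'
    set free : Finset (Fin n) := (F.image Prod.snd)ᶜ with hfree
    have hfreec : n ≤ 2 * free.card := by
      have h1 : (F.image Prod.snd).card ≤ F.card := card_image_le
      rw [hfree, card_compl, Fintype.card_fin]
      omega
    have hfiber : ∀ v ∈ free, c'.card ≤ (c.filter fun σ => σ e.1 = v).card := by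
      intro v hv
      refine card_le_card_of_injOn (fun σ => Equiv.swap e.2 v * σ) ?_
        fun σ _ τ _ h => mul_left_cancel h
      intro σ hσ
      simp only [hc, hc', coe_filter, mem_filter, mem_univ, true_and, forall_mem_insert] at hσ ⊢
      change (∀ d ∈ F, Equiv.swap e.2 v (σ d.1) = d.2) ∧ Equiv.swap e.2 v (σ e.1) = v
      refine ⟨fun d hd => ?_, by rw [hσ.1, Equiv.swap_apply_left]⟩
      rw [hσ.2 d hd]
      refine Equiv.swap_apply_of_ne_of_ne ?_ ?_
      · exact (hF d (mem_insert_of_mem hd) e (mem_insert_self e F)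
          (fun h => he (h ▸ hd))).2
      · rintro rfl
        exact mem_compl.1 hv (mem_image_of_mem _ hd)
    have hsum : free.card * c'.card ≤ c.card := by
      calc free.card * c'.card = ∑ v ∈ free, c'.card := by simp
        _ ≤ ∑ v ∈ free, (c.filter fun σ => σ e.1 = v).card := sum_le_sum hfiber
        _ ≤ ∑ v, (c.filter fun σ => σ e.1 = v).card := sum_le_sum_of_subset (subset_univ _)
        _ = c.card := (card_eq_sum_card_fiberwise (by simp)).symm
    calc c'.card * n ^ (F.card + 1) = n * c'.card * n ^ F.card := by ring
      _ ≤ 2 * free.card * c'.card * n ^ F.card := by gcongr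
      _ = 2 * (free.card * c'.card * n ^ F.card) := by ring
      _ ≤ 2 * (c.card * n ^ F.card) := by gcongr
      _ ≤ 2 * (2 ^ F.card * n !) := by gcongr
      _ = 2 ^ (F.card + 1) * n ! := by ring

/-- The permutations whose graph contains a minimal member of `A` with at least `h` edges. -/
noncomputable def largeHits (A : Finset (Finset (Fin n × Fin n))) (h : ℕ) :
    Finset (Equiv.Perm (Fin n)) :=
  univ.filter fun σ => ∃ F ∈ A, (∀ K ∈ A, K ⊆ F → K = F) ∧ h ≤ F.card ∧ ∀ e ∈ F, σ e.1 = e.2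

theorem RobustlyClosed.card_largeHits_le {A : Finset (Finset (Fin n × Fin n))} {r : ℕ}
    (hA : RobustlyClosed M q w A) (hr : 16 * (q + 1) ≤ r) (hw : 0 < w)
    (hn : 8 * (w * r ^ 2) ≤ n) (h : ℕ) :
    ((largeHits A h).card : ℝ) ≤ 2 * (1 / 4) ^ h * n ! := by
  have hr0 : 0 < r := by omega
  have hR : w ≤ w * r ^ 2 := Nat.le_mul_of_pos_right _ (by positivity)
  let a : ℕ → ℕ := fun k => ∑ F ∈ minimalOfCard A k,
    (univ.filter fun σ : Equiv.Perm (Fin n) => ∀ e ∈ F, σ e.1 = e.2).card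
  have ha : ∀ k ≤ w, 4 ^ k * a k ≤ n ! := by
    intro k hk
    have h1 : a k * n ^ k ≤ (w * r ^ 2) ^ k * (2 ^ k * n !) := by
      rw [sum_mul]
      calc _ ≤ ∑ F ∈ minimalOfCard A k, 2 ^ k * n ! := by
            refine sum_le_sum fun F hF => ?_
            obtain ⟨hFA, hFk, -⟩ := mem_filter.1 hF
            have := card_perm_extending_le F (mem_smallMatchings.1 (hA.1 hFA)).1 (by omega)
            rwa [hFk] at this
        _ = (minimalOfCard A k).card * (2 ^ k * n !) := by simp
        _ ≤ _ := by
            gcongr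
            exact hA.card_minimalOfCard_le hr hw
    have hpos : 0 < (2 * (w * r ^ 2)) ^ k := by positivity
    refine Nat.le_of_mul_le_mul_right ?_ hpos
    calc 4 ^ k * a k * (2 * (w * r ^ 2)) ^ k = a k * (8 * (w * r ^ 2)) ^ k := by
          rw [show 8 * (w * r ^ 2) = 4 * (2 * (w * r ^ 2)) by ring, mul_pow 4]; ring
      _ ≤ a k * n ^ k := by gcongr
      _ ≤ (w * r ^ 2) ^ k * (2 ^ k * n !) := h1
      _ = n ! * (2 * (w * r ^ 2)) ^ k := by rw [mul_pow 2]; ring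
  have hsub : largeHits A h ⊆ (Ico h (w + 1)).biUnion fun k => (minimalOfCard A k).biUnion fun F =>
      univ.filter fun σ : Equiv.Perm (Fin n) => ∀ e ∈ F, σ e.1 = e.2 := by
    intro σ hσ
    obtain ⟨F, hFA, hFmin, hFh, hFσ⟩ := (mem_filter.1 hσ).2
    have hFw := (mem_smallMatchings.1 (hA.1 hFA)).2
    refine mem_biUnion.2 ⟨F.card, mem_Ico.2 ⟨hFh, by omega⟩, mem_biUnion.2 ⟨F, ?_, ?_⟩⟩
    · exact mem_filter.2 ⟨hFA, rfl, hFmin⟩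
    · exact mem_filter.2 ⟨mem_univ _, hFσ⟩
  have hcard : (largeHits A h).card ≤ ∑ k ∈ Ico h (w + 1), a k :=
    (card_le_card hsub).trans (card_biUnion_le.trans (sum_le_sum fun k _ => card_biUnion_le))
  calc ((largeHits A h).card : ℝ) ≤ ∑ k ∈ Ico h (w + 1), (a k : ℝ) := by exact_mod_cast hcard
    _ ≤ ∑ k ∈ Ico h (w + 1), (1 / 4 : ℝ) ^ k * n ! := by
        refine sum_le_sum fun k hk => ?_
        have h1 : (4 : ℝ) ^ k * a k ≤ n ! := by
          exact_mod_cast ha k (by have := (mem_Ico.1 hk).2; omega)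
        rw [one_div, inv_pow, inv_mul_eq_div, le_div_iff₀ (by positivity)]
        linarith
    _ ≤ (1 / 4 : ℝ) ^ h / (1 - 1 / 4) * n ! := by
        rw [← sum_mul]
        gcongr
        exact geom_sum_Ico_le_of_lt_one (by norm_num) (by norm_num)
    _ ≤ 2 * (1 / 4) ^ h * n ! := by
        gcongr
        have : (0 : ℝ) ≤ (1 / 4) ^ h := by positivity
        rw [div_le_iff₀ (by norm_num)]
        linarith

theorem exists_minimal_mem_subset (A : Finset (Finset (Fin n × Fin n)))
    {F : Finset (Fin n × Fin n)} (hF : F ∈ A) :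
    ∃ G ∈ A, G ⊆ F ∧ ∀ K ∈ A, K ⊆ G → K = G := by
  obtain ⟨G, hG, hmin⟩ := exists_min_image (A.filter (· ⊆ F)) card
    ⟨F, mem_filter.2 ⟨hF, Subset.rfl⟩⟩
  obtain ⟨hGA, hGF⟩ := mem_filter.1 hG
  exact ⟨G, hGA, hGF, fun K hK hKG =>
    eq_of_subset_of_card_le hKG (hmin K (mem_filter.2 ⟨hK, hKG.trans hGF⟩))⟩

theorem isMatching_of_forall_perm {F : Finset (Fin n × Fin n)} {σ : Equiv.Perm (Fin n)}
    (h : ∀ e ∈ F, σ e.1 = e.2) : IsMatching F := by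
  intro e he e' he' hne
  refine ⟨fun h1 => hne ?_, fun h2 => hne ?_⟩
  · exact Prod.ext h1 (by rw [← h e he, ← h e' he', h1])
  · exact Prod.ext (σ.injective (by rw [h e he, h e' he', h2])) h2

theorem accepts_inter_or_mem_largeHits {A B : Finset (Finset (Fin n × Fin n))} {h : ℕ}
    (hA : RobustlyClosed M q (2 * h) A) (hB : RobustlyClosed M q (2 * h) B)
    {σ : Equiv.Perm (Fin n)} (hσA : Accepts A fun e => σ e.1 = e.2)
    (hσB : Accepts B fun e => σ e.1 = e.2) :
    Accepts (A ∩ B) (fun e => σ e.1 = e.2) ∨ σ ∈ largeHits A h ∪ largeHits B h := by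
  obtain ⟨F', hF', hF'σ⟩ := hσA
  obtain ⟨G', hG', hG'σ⟩ := hσB
  obtain ⟨F, hF, hFF', hFmin⟩ := exists_minimal_mem_subset A hF'
  obtain ⟨G, hG, hGG', hGmin⟩ := exists_minimal_mem_subset B hG'
  have hFσ : ∀ e ∈ F, σ e.1 = e.2 := fun e he => hF'σ e (hFF' he)
  have hGσ : ∀ e ∈ G, σ e.1 = e.2 := fun e he => hG'σ e (hGG' he)
  by_cases hFh : h ≤ F.card
  · exact Or.inr (mem_union_left _ (mem_filter.2 ⟨mem_univ _, F, hF, hFmin, hFh, hFσ⟩))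
  by_cases hGh : h ≤ G.card
  · exact Or.inr (mem_union_right _ (mem_filter.2 ⟨mem_univ _, G, hG, hGmin, hGh, hGσ⟩))
  have hFG : ∀ e ∈ F ∪ G, σ e.1 = e.2 := fun e he => (mem_union.1 he).elim (hFσ e) (hGσ e)
  have hsmall : F ∪ G ∈ smallMatchings n (2 * h) := mem_smallMatchings.2
    ⟨isMatching_of_forall_perm hFG, (card_union_le F G).trans (by omega)⟩
  exact Or.inl ⟨F ∪ G, mem_inter.2 ⟨hA.mem_of_superset hF subset_union_left hsmall,
    hB.mem_of_superset hG subset_union_right hsmall⟩, hFG⟩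

theorem matchProp_perm (σ : Equiv.Perm (Fin n)) :
    MatchProp n fun e => decide (σ e.1 = e.2) := by
  have h : ∀ e ∈ univ.image fun i => (i, σ i), σ e.1 = e.2 := by simp
  refine ⟨univ.image fun i => (i, σ i), isMatching_of_forall_perm h, ?_, by simp⟩
  rw [card_image_of_injective _ fun i j hij => (Prod.ext_iff.1 hij).1]
  simp

theorem not_matchProp_touches {Y : Finset (Fin n ⊕ Fin n)} (hY : Y.card < n) :
    ¬ MatchProp n fun e => decide (Touches Y e) := by
  rintro ⟨F, hF, hFn, hFY⟩
  refine absurd ?_ (not_le.2 hY)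
  refine hFn.symm.le.trans (card_le_card_of_injOn
    (fun e => if Sum.inl e.1 ∈ Y then Sum.inl e.1 else Sum.inr e.2) ?_ ?_)
  · intro e he
    have := of_decide_eq_true (hFY e he)
    by_cases h : Sum.inl e.1 ∈ Y
    · simp [h]
    · simpa [h] using this.resolve_left h
  · intro e he e' he' h
    by_cases h1 : Sum.inl e.1 ∈ Y <;> by_cases h2 : Sum.inl e'.1 ∈ Y <;> simp [h1, h2] at h
    · exact hF.eq_of_fst_eq he he' h
    · exact hF.eq_of_snd_eq he he' h

/-- Under the numerical conditions balancing the two kinds of errors, no monotone circuit of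
size at most `2 ^ s` computes perfect matching. -/
theorem not_computes_matchProp {s r : ℕ} (hn : 0 < n) (hM : 4 * M ≤ q + 1)
    (hr : 16 * (q + 1) ≤ r)
    (hMS : 2 * 2 ^ s * (n * n + 1) ^ (2 * (s + 2)) * 4 ^ (2 * (s + 2)) < 2 ^ M)
    (hRn : 8 * (2 * (s + 2) * r ^ 2) ≤ n)
    (C : MonCircuit (Fin n × Fin n)) (hC : C.size ≤ 2 ^ s) : ¬ C.Computes (MatchProp n) := by
  rintro ⟨hsize, hcomp⟩
  set h := s + 2 with hh
  set out : Fin C.size := ⟨C.size - 1, Nat.sub_lt hsize Nat.one_pos⟩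
  set T := Fintype.card (Fin M → Fin n ⊕ Fin n → Fin (q + 1))
  have hTpos : 0 < T := Fintype.card_pos
  have hSR : (C.size : ℝ) ≤ 2 ^ s := by exact_mod_cast hC
  have hw : 0 < 2 * h := by omega
  have hcl := exists_robustlyClosed (n := n) M q (2 * h)
  choose! cl hcl_sub hcl_closed hcl_err using hcl
  set Bneg : ℝ := (smallMatchings n (2 * h)).card * (4 ^ (2 * h) * T) / 2 ^ M with hBneg
  have hneg : ∀ A ⊆ smallMatchings n (2 * h),
      ∀ D : Finset (Fin M → Fin n ⊕ Fin n → Fin (q + 1)),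
        (∀ ω ∈ D, Accepts (cl A) (Touches (coverSet ω)) ∧ ¬ Accepts A (Touches (coverSet ω))) →
        (D.card : ℝ) ≤ Bneg := by
    intro A hA D hD
    rw [hBneg, le_div_iff₀ (by positivity), mul_comm]
    have h1 := card_le_card fun ω hω => mem_filter.2 ⟨mem_univ ω, hD ω hω⟩
    exact_mod_cast (Nat.mul_le_mul_left _ h1).trans
      ((hcl_err A hA).trans (Nat.mul_le_mul_right _ (card_le_card sdiff_subset)))
  have hBneg0 : 0 ≤ Bneg := by positivity
  let leaf : Fin n × Fin n → Finset (Finset (Fin n × Fin n)) := fun e => cl {{e}}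
  let disj : Finset (Finset (Fin n × Fin n)) → Finset (Finset (Fin n × Fin n)) →
      Finset (Finset (Fin n × Fin n)) := fun A B => cl (A ∪ B)
  have hleaf : ∀ e : Fin n × Fin n, {{e}} ⊆ smallMatchings n (2 * h) := by
    intro e
    rw [singleton_subset_iff, mem_smallMatchings]
    refine ⟨fun d hd d' hd' hne => absurd ?_ hne, by simp; omega⟩
    rw [mem_singleton.1 hd, mem_singleton.1 hd']
  have haccept_or : ∀ (A B : Finset (Finset (Fin n × Fin n))) P,
      Accepts (A ∪ B) P ↔ Accepts A P ∨ Accepts B P := by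
    intro A B P
    simp only [Accepts, mem_union, or_and_right, exists_or]
  have haccept_leaf : ∀ (e : Fin n × Fin n) P, Accepts {{e}} P ↔ P e := by
    intro e P
    refine ⟨fun ⟨F, hF, h⟩ => h e ?_, fun h => ⟨{e}, mem_singleton_self _, fun d hd => ?_⟩⟩
    · rw [mem_singleton.1 hF]
      exact mem_singleton_self e
    · rwa [mem_singleton.1 hd]
  have hmono : ∀ {A B : Finset (Finset (Fin n × Fin n))} {P}, A ⊆ B → Accepts A P →
      Accepts B P := fun hAB ⟨F, hF, hP⟩ => ⟨F, hAB hF, hP⟩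
  -- errors on the graphs of edges touching the random cover
  obtain ⟨hclosed, hnegerr⟩ := C.card_error_le (Ω := Fin M → Fin n ⊕ Fin n → Fin (q + 1))
    leaf (· ∩ ·) disj (RobustlyClosed M q (2 * h))
    (fun A ω => Accepts A (Touches (coverSet ω))) (fun ω e => decide (Touches (coverSet ω) e))
    (fun p q => p ∧ ¬ q) (by tauto) (by tauto) (by tauto) (by tauto) Bneg
    (fun e => ⟨hcl_closed _ (hleaf e), fun D hD => hneg _ (hleaf e) D fun ω hω =>
      ⟨(hD ω hω).1, fun h => (hD ω hω).2 (decide_eq_true ((haccept_leaf e _).1 h))⟩⟩)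
    (fun A B hA hB => ⟨hA.inter hB, fun D hD => by
      rw [eq_empty_of_forall_notMem fun ω hω => (hD ω hω).2
        ⟨hmono inter_subset_left (hD ω hω).1, hmono inter_subset_right (hD ω hω).1⟩]
      simpa using hBneg0⟩)
    (fun A B hA hB => ⟨hcl_closed _ (union_subset hA.1 hB.1), fun D hD =>
      hneg _ (union_subset hA.1 hB.1) D fun ω hω =>
        ⟨(hD ω hω).1, fun h => (hD ω hω).2 ((haccept_or A B _).1 h)⟩⟩) out
  -- errors on the perfect matchings
  obtain ⟨-, hposerr⟩ := C.card_error_le (Ω := Equiv.Perm (Fin n))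
    leaf (· ∩ ·) disj (RobustlyClosed M q (2 * h))
    (fun A σ => Accepts A fun e => σ e.1 = e.2) (fun σ e => decide (σ e.1 = e.2))
    (fun p q => q ∧ ¬ p) (by tauto) (by tauto) (by tauto) (by tauto)
    (4 * (1 / 4) ^ h * n !)
    (fun e => ⟨hcl_closed _ (hleaf e), fun D hD => by
      rw [eq_empty_of_forall_notMem fun σ hσ => (hD σ hσ).2
        (hmono (hcl_sub _ (hleaf e)) ((haccept_leaf e _).2 (of_decide_eq_true (hD σ hσ).1)))]
      simp only [card_empty, Nat.cast_zero]
      positivity⟩)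
    (fun A B hA hB => ⟨hA.inter hB, fun D hD => by
      have hsub : D ⊆ largeHits A h ∪ largeHits B h := fun σ hσ =>
        (accepts_inter_or_mem_largeHits hA hB (hD σ hσ).1.1 (hD σ hσ).1.2).resolve_left
          (hD σ hσ).2
      have h1 := hA.card_largeHits_le hr hw hRn h
      have h2 := hB.card_largeHits_le hr hw hRn h
      have h3 : (D.card : ℝ) ≤ (largeHits A h).card + (largeHits B h).card := by
        exact_mod_cast (card_le_card hsub).trans (card_union_le _ _)
      linarith⟩)
    (fun A B hA hB => ⟨hcl_closed _ (union_subset hA.1 hB.1), fun D hD => by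
      rw [eq_empty_of_forall_notMem fun σ hσ => (hD σ hσ).2
        (hmono (hcl_sub _ (union_subset hA.1 hB.1)) ((haccept_or A B _).2 (hD σ hσ).1))]
      simp only [card_empty, Nat.cast_zero]
      positivity⟩) out
  set A := C.interp leaf (· ∩ ·) disj out
  by_cases hempty : ∅ ∈ A
  · have h1 : (T : ℝ) ≤ 2 * (C.size * Bneg) := by
      have h2 := card_small_coverSet (V := Fin n ⊕ Fin n) hM n hn (by simp; ring)
      have h3 : (T : ℝ) ≤ 2 * ((univ.filter fun ω : Fin M → Fin n ⊕ Fin n → Fin (q + 1) =>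
          (coverSet ω).card < n).card : ℝ) := by exact_mod_cast h2
      have h4 := hnegerr (univ.filter fun ω => (coverSet ω).card < n) fun ω hω =>
        ⟨⟨∅, hempty, by simp⟩, fun hev =>
          not_matchProp_touches (mem_filter.1 hω).2 ((hcomp _).1 hev)⟩
      linarith
    have h5 : ((smallMatchings n (2 * h)).card : ℝ) ≤ (n * n + 1) ^ (2 * h) := by
      exact_mod_cast card_smallMatchings_le n (2 * h)
    have h6 : (2 * 2 ^ s * (n * n + 1) ^ (2 * h) * 4 ^ (2 * h) : ℝ) < 2 ^ M := by
      exact_mod_cast hMS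
    have hTR : (0 : ℝ) < T := by exact_mod_cast hTpos
    have h7 : 2 * (C.size * Bneg) * 2 ^ M < T * 2 ^ M := by
      calc 2 * (C.size * Bneg) * 2 ^ M
          = 2 * C.size * (smallMatchings n (2 * h)).card * 4 ^ (2 * h) * T := by
            rw [hBneg]; field_simp
        _ ≤ 2 * 2 ^ s * (n * n + 1) ^ (2 * h) * 4 ^ (2 * h) * T := by gcongr
        _ < 2 ^ M * T := by gcongr
        _ = T * 2 ^ M := mul_comm _ _
    exact absurd h1 (not_le.2 (lt_of_mul_lt_mul_right h7 (by positivity)))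
  · set D : Finset (Equiv.Perm (Fin n)) := univ.filter fun σ => ¬ Accepts A fun e => σ e.1 = e.2
    have hsub : (univ : Finset (Equiv.Perm (Fin n))) ⊆ largeHits A 1 ∪ D := by
      intro σ _
      by_cases hacc : Accepts A fun e => σ e.1 = e.2
      · obtain ⟨F', hF', hF'σ⟩ := hacc
        obtain ⟨F, hF, hFF', hFmin⟩ := exists_minimal_mem_subset A hF'
        refine mem_union_left _ (mem_filter.2 ⟨mem_univ _, F, hF, hFmin, ?_,
          fun e he => hF'σ e (hFF' he)⟩)
        exact card_pos.2 (nonempty_iff_ne_empty.2 fun h => hempty (h ▸ hF))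
      · exact mem_union_right _ (mem_filter.2 ⟨mem_univ _, hacc⟩)
    have h1 := (card_le_card hsub).trans (card_union_le _ _)
    rw [card_univ, Fintype.card_perm, Fintype.card_fin] at h1
    have h2 := hclosed.card_largeHits_le hr hw hRn 1
    have hD := hposerr D fun σ hσ => ⟨(hcomp _).2 (matchProp_perm σ), (mem_filter.1 hσ).2⟩
    have h3 : (n ! : ℝ) ≤ 2 * (1 / 4) ^ 1 * n ! + C.size * (4 * (1 / 4) ^ h * n !) :=
      le_trans (by exact_mod_cast h1) (add_le_add h2 hD)
    have hfac : (0 : ℝ) < n ! := by exact_mod_cast Nat.factorial_pos n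
    have h4 : (C.size : ℝ) * (4 * (1 / 4) ^ h * n !) ≤ 1 / 4 * n ! := by
      calc (C.size : ℝ) * (4 * (1 / 4) ^ h * n !) ≤ 2 ^ s * (4 * (1 / 4) ^ h * n !) := by gcongr
        _ = (2 * (1 / 4)) ^ s * (1 / 4) * n ! := by rw [hh, pow_add, mul_pow]; ring
        _ ≤ 1 * (1 / 4) * n ! := by
            gcongr
            exact pow_le_one₀ (by norm_num) (by norm_num)
        _ = 1 / 4 * n ! := by ring
    linarith

theorem lt_of_computes_matchProp {s L : ℕ} (hn : 0 < n) (hnL : n ≤ 2 ^ L)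
    (C : MonCircuit (Fin n × Fin n)) (hC : C.size ≤ 2 ^ s) (hcomp : C.Computes (MatchProp n)) :
    n < 8 * (2 * (s + 2) * (64 * (s + 2 + 2 * (s + 2) * (2 * L + 3))) ^ 2) := by
  by_contra hlt
  set M := s + 2 + 2 * (s + 2) * (2 * L + 3) with hM
  refine not_computes_matchProp (M := M) (q := 4 * M - 1) (r := 64 * M) (s := s) hn (by omega)
    (by omega) ?_ (not_lt.1 hlt) C hC hcomp
  have h1 : n * n + 1 ≤ 2 ^ (2 * L + 1) := by
    have h2 : n * n ≤ 2 ^ L * 2 ^ L := Nat.mul_le_mul hnL hnL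
    have h3 : 1 ≤ 2 ^ L * 2 ^ L := Nat.one_le_iff_ne_zero.2 (by positivity)
    calc n * n + 1 ≤ 2 ^ L * 2 ^ L + 2 ^ L * 2 ^ L := by omega
      _ = 2 ^ (2 * L + 1) := by ring
  calc 2 * 2 ^ s * (n * n + 1) ^ (2 * (s + 2)) * 4 ^ (2 * (s + 2))
      ≤ 2 * 2 ^ s * (2 ^ (2 * L + 1)) ^ (2 * (s + 2)) * (2 ^ 2) ^ (2 * (s + 2)) := by
        gcongr
        norm_num
    _ = 2 ^ (1 + s + (2 * L + 1) * (2 * (s + 2)) + 2 * (2 * (s + 2))) := by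
        rw [← pow_mul, ← pow_mul, pow_add, pow_add, pow_add, pow_one]
    _ < 2 ^ M := by
        refine Nat.pow_lt_pow_right (by norm_num) ?_
        rw [hM]
        nlinarith

theorem le_two_pow_ceil_logb {m : ℕ} (hm : 0 < m) : m ≤ 2 ^ ⌈Real.logb 2 m⌉₊ := by
  have hm' : (0 : ℝ) < m := by exact_mod_cast hm
  have h : (m : ℝ) ≤ 2 ^ ⌈Real.logb 2 m⌉₊ := by
    rw [← Real.rpow_natCast, ← Real.logb_le_iff_le_rpow (by norm_num) hm']
    exact Nat.le_ceil _
  exact_mod_cast h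

end PerfectMatchings

/-- There is a constant `c > 0` such that for all `n ≥ 2`: if a monotone circuit of size `S`
computes `Match_n`, then `(log₂ S + 1)³ · (log₂ n)² ≥ c · n`. -/
theorem match_monotone_tradeoff :
    ∃ c : ℝ, 0 < c ∧ ∀ n : ℕ, 2 ≤ n →
      ∀ C : MonCircuit (Fin n × Fin n), C.Computes (MatchProp n) →
        c * (n : ℝ) ≤ (Real.logb 2 (C.size : ℝ) + 1) ^ 3 * (Real.logb 2 (n : ℝ)) ^ 2 := by
  refine ⟨1 / 398131200, by norm_num, fun n hn C hC => ?_⟩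
  have hsize : 0 < C.size := hC.1
  set a := Real.logb 2 (C.size : ℝ) + 1 with ha
  set l := Real.logb 2 (n : ℝ) with hl
  have hS0 : 0 ≤ Real.logb 2 (C.size : ℝ) :=
    Real.logb_nonneg (by norm_num) (by exact_mod_cast hsize)
  have hl1 : 1 ≤ l := by
    rw [hl, Real.le_logb_iff_rpow_le (by norm_num) (by positivity), Real.rpow_one]
    exact_mod_cast hn
  have ha1 : 1 ≤ a := by linarith
  have hs : (⌈Real.logb 2 (C.size : ℝ)⌉₊ : ℝ) ≤ a := (Nat.ceil_lt_add_one hS0).le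
  have hL : (⌈l⌉₊ : ℝ) ≤ 2 * l := by
    have := Nat.ceil_lt_add_one (zero_le_one.trans hl1)
    linarith
  have key := lt_of_computes_matchProp (by omega) (le_two_pow_ceil_logb (by omega : 0 < n)) C
    (le_two_pow_ceil_logb hsize) hC
  rw [← hl] at key
  set s := ⌈Real.logb 2 (C.size : ℝ)⌉₊
  set L := ⌈l⌉₊
  have key' : (n : ℝ) ≤
      8 * (2 * (s + 2) * (64 * (s + 2 + 2 * (s + 2) * (2 * L + 3))) ^ 2) := by
    exact_mod_cast key.le
  have hw : 2 * ((s : ℝ) + 2) ≤ 6 * a := by linarith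
  have hal : a ≤ a * l := le_mul_of_one_le_right (by linarith) hl1
  have hM : (s : ℝ) + 2 + 2 * (s + 2) * (2 * L + 3) ≤ 45 * (a * l) := by
    have h1 : 2 * ((s : ℝ) + 2) * (2 * L + 3) ≤ 6 * a * (7 * l) := by
      gcongr
      linarith
    nlinarith
  have hfin : (n : ℝ) ≤ 8 * (6 * a * (64 * (45 * (a * l))) ^ 2) := by
    refine key'.trans ?_
    gcongr
  calc 1 / 398131200 * (n : ℝ) ≤ 1 / 398131200 * (8 * (6 * a * (64 * (45 * (a * l))) ^ 2)) := by
        gcongr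
    _ = a ^ 3 * l ^ 2 := by ring
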